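/- arXiv:0812.1304 — 4 statements merged into one kernel-verified Lean document; each statement's English description precedes it below -/
import Mathlib

section
/- Every SG-hereditary commutative ring is SG-semihereditary; that is, if every submodule of a projective R-module is strongly Gorenstein projective, then R is coherent and every submodule of a flat R-module is strongly Gorenstein flat. -/
noncomputable section

universe u

variable (R : Type u) [CommRing R]

/-- `IsShortExact R f g` says that `0 → A → B → C → 0` is a short exact sequence. -/
def IsShortExact {A B C : Type u} [AddCommGroup A] [Module R A] [AddCommGroup B] [Module R B]
    [AddCommGroup C] [Module R C] (f : A →ₗ[R] B) (g : B →ₗ[R] C) : Prop :=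
  Function.Injective f ∧ Function.Surjective g ∧ LinearMap.range f = LinearMap.ker g

/-- A module `M` is Gorenstein projective if there is a complete projective resolution
`⋯ → P i → P (i+1) → ⋯` (an exact sequence of projective modules which remains exact after
applying `Hom(-, Q)` for every projective module `Q`) with `M ≅ Im (P 0 → P 1)`. -/
def IsGorensteinProjective (M : Type u) [AddCommGroup M] [Module R M] : Prop :=
  ∃ (P : ℤ → Type u) (_ : ∀ i, AddCommGroup (P i)) (_ : ∀ i, Module R (P i))
    (d : ∀ i, P i →ₗ[R] P (i + 1)),
    (∀ i, Module.Projective R (P i)) ∧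
    (∀ i, LinearMap.range (d i) = LinearMap.ker (d (i + 1))) ∧
    Nonempty (M ≃ₗ[R] LinearMap.range (d 0)) ∧
    (∀ (Q : Type u) (_ : AddCommGroup Q) (_ : Module R Q), Module.Projective R Q →
      ∀ (i : ℤ) (g : P (i + 1) →ₗ[R] Q), g.comp (d i) = 0 →
        ∃ h : P (i + 1 + 1) →ₗ[R] Q, h.comp (d (i + 1)) = g)

/-- A module `M` is strongly Gorenstein projective if there is a complete projective
resolution of the form `⋯ → P →f P →f P → ⋯` with `M ≅ Im f`. -/
def IsStronglyGorensteinProjective (M : Type u) [AddCommGroup M] [Module R M] : Prop :=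
  ∃ (P : Type u) (_ : AddCommGroup P) (_ : Module R P) (f : P →ₗ[R] P),
    Module.Projective R P ∧
    LinearMap.range f = LinearMap.ker f ∧
    Nonempty (M ≃ₗ[R] LinearMap.range f) ∧
    (∀ (Q : Type u) (_ : AddCommGroup Q) (_ : Module R Q), Module.Projective R Q →
      ∀ g : P →ₗ[R] Q, g.comp f = 0 → ∃ h : P →ₗ[R] Q, h.comp f = g)

/-- A module `M` is Gorenstein flat if there is an exact sequence of flat modules
`⋯ → F i → F (i+1) → ⋯` which remains exact after applying `- ⊗ I` for every injective
module `I`, with `M ≅ Im (F 0 → F 1)`. -/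
def IsGorensteinFlat (M : Type u) [AddCommGroup M] [Module R M] : Prop :=
  ∃ (F : ℤ → Type u) (_ : ∀ i, AddCommGroup (F i)) (_ : ∀ i, Module R (F i))
    (d : ∀ i, F i →ₗ[R] F (i + 1)),
    (∀ i, Module.Flat R (F i)) ∧
    (∀ i, LinearMap.range (d i) = LinearMap.ker (d (i + 1))) ∧
    Nonempty (M ≃ₗ[R] LinearMap.range (d 0)) ∧
    (∀ (I : Type u) (_ : AddCommGroup I) (_ : Module R I), Module.Injective R I →
      ∀ i : ℤ, LinearMap.range (LinearMap.rTensor I (d i)) =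
        LinearMap.ker (LinearMap.rTensor I (d (i + 1))))

/-- A module `M` is strongly Gorenstein flat if there is an exact sequence of flat modules
of the form `⋯ → F →f F →f F → ⋯` which remains exact after applying `- ⊗ I` for every
injective module `I`, with `M ≅ Im f`. -/
def IsStronglyGorensteinFlat (M : Type u) [AddCommGroup M] [Module R M] : Prop :=
  ∃ (F : Type u) (_ : AddCommGroup F) (_ : Module R F) (f : F →ₗ[R] F),
    Module.Flat R F ∧
    LinearMap.range f = LinearMap.ker f ∧
    Nonempty (M ≃ₗ[R] LinearMap.range f) ∧
    (∀ (I : Type u) (_ : AddCommGroup I) (_ : Module R I), Module.Injective R I →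
      LinearMap.range (LinearMap.rTensor I f) = LinearMap.ker (LinearMap.rTensor I f))

/-- `ProjDimLE R M n` : the projective dimension of `M` is at most `n`, i.e. there is an exact
sequence `0 → P n → ⋯ → P 0 → M → 0` with each `P i` projective. -/
def ProjDimLE (M : Type u) [AddCommGroup M] [Module R M] (n : ℕ) : Prop :=
  ∃ (P : ℕ → Type u) (_ : ∀ i, AddCommGroup (P i)) (_ : ∀ i, Module R (P i))
    (d : ∀ i, P (i + 1) →ₗ[R] P i) (ε : P 0 →ₗ[R] M),
    (∀ i, Module.Projective R (P i)) ∧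
    (∀ i, n < i → Subsingleton (P i)) ∧
    Function.Surjective ε ∧
    LinearMap.ker ε = LinearMap.range (d 0) ∧
    (∀ i, LinearMap.ker (d i) = LinearMap.range (d (i + 1)))

/-- `InjDimLE R M n` : the injective dimension of `M` is at most `n`, i.e. there is an exact
sequence `0 → M → E 0 → ⋯ → E n → 0` with each `E i` injective. -/
def InjDimLE (M : Type u) [AddCommGroup M] [Module R M] (n : ℕ) : Prop :=
  ∃ (E : ℕ → Type u) (_ : ∀ i, AddCommGroup (E i)) (_ : ∀ i, Module R (E i))
    (d : ∀ i, E i →ₗ[R] E (i + 1)) (η : M →ₗ[R] E 0),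
    (∀ i, Module.Injective R (E i)) ∧
    (∀ i, n < i → Subsingleton (E i)) ∧
    Function.Injective η ∧
    LinearMap.range η = LinearMap.ker (d 0) ∧
    (∀ i, LinearMap.range (d i) = LinearMap.ker (d (i + 1)))

/-- `FlatDimLE R M n` : the flat dimension of `M` is at most `n`. -/
def FlatDimLE (M : Type u) [AddCommGroup M] [Module R M] (n : ℕ) : Prop :=
  ∃ (F : ℕ → Type u) (_ : ∀ i, AddCommGroup (F i)) (_ : ∀ i, Module R (F i))
    (d : ∀ i, F (i + 1) →ₗ[R] F i) (ε : F 0 →ₗ[R] M),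
    (∀ i, Module.Flat R (F i)) ∧
    (∀ i, n < i → Subsingleton (F i)) ∧
    Function.Surjective ε ∧
    LinearMap.ker ε = LinearMap.range (d 0) ∧
    (∀ i, LinearMap.ker (d i) = LinearMap.range (d (i + 1)))

/-- `GProjDimLE R M n` : the Gorenstein projective dimension of `M` is at most `n`, i.e.
there is an exact sequence `0 → G n → ⋯ → G 0 → M → 0` with each `G i` Gorenstein
projective. -/
def GProjDimLE (M : Type u) [AddCommGroup M] [Module R M] (n : ℕ) : Prop :=
  ∃ (G : ℕ → Type u) (_ : ∀ i, AddCommGroup (G i)) (_ : ∀ i, Module R (G i))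
    (d : ∀ i, G (i + 1) →ₗ[R] G i) (ε : G 0 →ₗ[R] M),
    (∀ i, IsGorensteinProjective R (G i)) ∧
    (∀ i, n < i → Subsingleton (G i)) ∧
    Function.Surjective ε ∧
    LinearMap.ker ε = LinearMap.range (d 0) ∧
    (∀ i, LinearMap.ker (d i) = LinearMap.range (d (i + 1)))

/-- `GFlatDimLE R M n` : the Gorenstein flat dimension of `M` is at most `n`. -/
def GFlatDimLE (M : Type u) [AddCommGroup M] [Module R M] (n : ℕ) : Prop :=
  ∃ (G : ℕ → Type u) (_ : ∀ i, AddCommGroup (G i)) (_ : ∀ i, Module R (G i))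
    (d : ∀ i, G (i + 1) →ₗ[R] G i) (ε : G 0 →ₗ[R] M),
    (∀ i, IsGorensteinFlat R (G i)) ∧
    (∀ i, n < i → Subsingleton (G i)) ∧
    Function.Surjective ε ∧
    LinearMap.ker ε = LinearMap.range (d 0) ∧
    (∀ i, LinearMap.ker (d i) = LinearMap.range (d (i + 1)))

/-- A module is finitely presented if it is the quotient of a finite free module by a
finitely generated submodule of relations. -/
def IsFinitelyPresented (M : Type u) [AddCommGroup M] [Module R M] : Prop :=
  ∃ (n : ℕ) (f : (Fin n → R) →ₗ[R] M), Function.Surjective f ∧ (LinearMap.ker f).FG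

/-- A ring is coherent if every finitely generated ideal is finitely presented. -/
def IsCoherentRing : Prop :=
  ∀ I : Ideal R, I.FG → IsFinitelyPresented R I

/-- `ExtVanishes R M N i` : `Ext_R^i(M, N) = 0`. -/
def ExtVanishes (M N : Type u) [AddCommGroup M] [Module R M] [AddCommGroup N] [Module R N]
    (i : ℕ) : Prop :=
  Subsingleton (((Ext R (ModuleCat.{u} R) i).obj
    (Opposite.op (ModuleCat.of R M))).obj (ModuleCat.of R N))

/-- A ring is hereditary if every submodule of a projective module is projective. -/
def IsHereditaryRing : Prop :=
  ∀ (P : Type u) (_ : AddCommGroup P) (_ : Module R P), Module.Projective R P →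
    ∀ N : Submodule R P, Module.Projective R N

/-- A ring is semihereditary if every finitely generated ideal is projective. -/
def IsSemihereditaryRing : Prop :=
  ∀ I : Ideal R, I.FG → Module.Projective R I

/-- A ring is Gorenstein hereditary if every submodule of a projective module is
Gorenstein projective. -/
def IsGHereditaryRing : Prop :=
  ∀ (P : Type u) (_ : AddCommGroup P) (_ : Module R P), Module.Projective R P →
    ∀ N : Submodule R P, IsGorensteinProjective R N

/-- A ring is strongly Gorenstein hereditary if every submodule of a projective module is
strongly Gorenstein projective. -/
def IsSGHereditaryRing : Prop :=
  ∀ (P : Type u) (_ : AddCommGroup P) (_ : Module R P), Module.Projective R P →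
    ∀ N : Submodule R P, IsStronglyGorensteinProjective R N

/-- A ring is Gorenstein semihereditary if it is coherent and every submodule of a flat
module is Gorenstein flat. -/
def IsGSemihereditaryRing : Prop :=
  IsCoherentRing R ∧
    ∀ (F : Type u) (_ : AddCommGroup F) (_ : Module R F), Module.Flat R F →
      ∀ N : Submodule R F, IsGorensteinFlat R N

/-- A ring is strongly Gorenstein semihereditary if it is coherent and every submodule of a
flat module is strongly Gorenstein flat. -/
def IsSGSemihereditaryRing : Prop :=
  IsCoherentRing R ∧
    ∀ (F : Type u) (_ : AddCommGroup F) (_ : Module R F), Module.Flat R F →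
      ∀ N : Submodule R F, IsStronglyGorensteinFlat R N

open TensorProduct in
/-- `C ⊗ v` and `u ⊗ C'` commute. -/
theorem lTensor_rTensor_apply {R : Type*} [CommRing R] {C D C' D' : Type*} [AddCommGroup C]
    [Module R C] [AddCommGroup D] [Module R D] [AddCommGroup C'] [Module R C'] [AddCommGroup D']
    [Module R D'] (u : C →ₗ[R] D) (v : C' →ₗ[R] D') (z : C ⊗[R] C') :
    v.lTensor D (u.rTensor C' z) = u.rTensor D' (v.lTensor C z) := by
  rw [← LinearMap.comp_apply, ← LinearMap.comp_apply, LinearMap.lTensor_comp_rTensor,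
    LinearMap.rTensor_comp_lTensor]

/-- Balancing of `Tor₁`: for right exact sequences `A₁ → A₀ → A → 0` and `B₁ → B₀ → B → 0`,
injectivity of `A₁ ⊗ B₀ → A₀ ⊗ B₀` and of `A ⊗ B₁ → A ⊗ B₀` implies that of
`A₁ ⊗ B → A₀ ⊗ B`. -/
theorem rTensor_injective_of_lTensor_injective {R : Type*} [CommRing R]
    {A₁ A₀ A B₁ B₀ B : Type*} [AddCommGroup A₁] [Module R A₁] [AddCommGroup A₀] [Module R A₀]
    [AddCommGroup A] [Module R A] [AddCommGroup B₁] [Module R B₁] [AddCommGroup B₀] [Module R B₀]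
    [AddCommGroup B] [Module R B] {f : A₁ →ₗ[R] A₀} {g : A₀ →ₗ[R] A} {f' : B₁ →ₗ[R] B₀}
    {g' : B₀ →ₗ[R] B} (hfg : Function.Exact f g) (hg : Function.Surjective g)
    (hfg' : Function.Exact f' g') (hg' : Function.Surjective g')
    (hf : Function.Injective (f.rTensor B₀)) (hf' : Function.Injective (f'.lTensor A)) :
    Function.Injective (f.rTensor B) := by
  rw [injective_iff_map_eq_zero]
  intro x hx
  obtain ⟨x₀, rfl⟩ := LinearMap.lTensor_surjective A₁ hg' x
  rw [← lTensor_rTensor_apply] at hx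
  obtain ⟨y, hy⟩ := (lTensor_exact A₀ hfg' hg' _).1 hx
  have hy0 : g.rTensor B₁ y = 0 := by
    apply hf'
    rw [lTensor_rTensor_apply, hy, map_zero]
    exact (rTensor_exact B₀ hfg hg).apply_apply_eq_zero x₀
  obtain ⟨z, rfl⟩ := (rTensor_exact B₁ hfg hg _).1 hy0
  rw [lTensor_rTensor_apply] at hy
  rw [← hf hy]
  exact (lTensor_exact A₁ hfg' hg').apply_apply_eq_zero z

/-- If `k : A → B` is an injective map of flat modules and `N` embeds in a flat module, then
`N ⊗ A → N ⊗ B` is injective. -/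
theorem lTensor_injective_of_injective_to_flat {R : Type*} [CommRing R] {A B N F : Type*}
    [AddCommGroup A] [Module R A] [AddCommGroup B] [Module R B] [AddCommGroup N] [Module R N]
    [AddCommGroup F] [Module R F] [Module.Flat R A] [Module.Flat R F] {k : A →ₗ[R] B}
    (hk : Function.Injective k) {i : N →ₗ[R] F} (hi : Function.Injective i) :
    Function.Injective (k.lTensor N) := by
  have h : Function.Injective (i.rTensor B ∘ₗ k.lTensor N) := by
    rw [LinearMap.rTensor_comp_lTensor, ← LinearMap.lTensor_comp_rTensor]
    exact (Module.Flat.lTensor_preserves_injective_linearMap k hk).comp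
      (Module.Flat.rTensor_preserves_injective_linearMap i hi)
  exact Function.Injective.of_comp h

/-- In an extension `0 → N → E → N' → 0`, if `N ⊗ A → N ⊗ B` and `N' ⊗ A → N' ⊗ B` are
injective and `B` is flat, then `E ⊗ A → E ⊗ B` is injective. -/
theorem lTensor_injective_of_extension {R : Type*} [CommRing R] {A B N E N' : Type*}
    [AddCommGroup A] [Module R A] [AddCommGroup B] [Module R B] [AddCommGroup N] [Module R N]
    [AddCommGroup E] [Module R E] [AddCommGroup N'] [Module R N'] [Module.Flat R B]
    {k : A →ₗ[R] B} {i : N →ₗ[R] E} {p : E →ₗ[R] N'} (hi : Function.Injective i)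
    (hip : Function.Exact i p) (hp : Function.Surjective p)
    (hN : Function.Injective (k.lTensor N)) (hN' : Function.Injective (k.lTensor N')) :
    Function.Injective (k.lTensor E) := by
  rw [injective_iff_map_eq_zero]
  intro x hx
  have hpx : p.rTensor A x = 0 := by
    apply hN'
    rw [lTensor_rTensor_apply, hx, map_zero, map_zero]
  obtain ⟨z, rfl⟩ := (rTensor_exact A hip hp _).1 hpx
  have hz : z = 0 := by
    apply hN
    apply Module.Flat.rTensor_preserves_injective_linearMap (M := B) i hi
    rw [map_zero, map_zero, ← lTensor_rTensor_apply, hx]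
  rw [hz, map_zero]

/-- A module with a flat resolution `0 → A → B → E → 0` such that `A ⊗ X → B ⊗ X` is injective
for all `X` is flat. -/
theorem flat_of_rTensor_injective {R : Type u} [CommRing R] {A B E : Type u}
    [AddCommGroup A] [Module R A] [AddCommGroup B] [Module R B] [AddCommGroup E] [Module R E]
    [Module.Flat R B] {k : A →ₗ[R] B} {p : B →ₗ[R] E} (hkp : Function.Exact k p)
    (hp : Function.Surjective p)
    (h : ∀ (X : Type u) [AddCommGroup X] [Module R X], Function.Injective (k.rTensor X)) :
    Module.Flat R E := by
  rw [Module.Flat.iff_rTensor_preserves_injective_linearMap]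
  intro X Y _ _ _ _ j hj
  refine rTensor_injective_of_lTensor_injective (LinearMap.exact_map_mkQ_range j)
    (Submodule.mkQ_surjective _) hkp hp
    (Module.Flat.rTensor_preserves_injective_linearMap j hj) ?_
  rw [LinearMap.lTensor_inj_iff_rTensor_inj]
  exact h _

/-- Over a strongly Gorenstein hereditary ring, every module `N` fits into an exact sequence
`0 → N → E → N → 0` where `E` has projective dimension at most one. -/
theorem IsSGHereditaryRing.exists_self_extension {R : Type u} [CommRing R]
    (h : IsSGHereditaryRing R) (N : Type u) [AddCommGroup N] [Module R N] :
    ∃ (A B E : Type u) (_ : AddCommGroup A) (_ : Module R A) (_ : AddCommGroup B)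
      (_ : Module R B) (_ : AddCommGroup E) (_ : Module R E) (k : A →ₗ[R] B) (q : B →ₗ[R] E)
      (i : N →ₗ[R] E) (p : E →ₗ[R] N), Module.Projective R A ∧ Module.Projective R B ∧
      Function.Injective k ∧ Function.Exact k q ∧ Function.Surjective q ∧
      Function.Injective i ∧ Function.Exact i p ∧ Function.Surjective p := by
  let P := N →₀ R
  let π : P →ₗ[R] N := Finsupp.linearCombination R id
  have hπ : Function.Surjective π := Finsupp.linearCombination_id_surjective R N
  obtain ⟨A, _, _, f, hA, hf, ⟨e⟩, hext⟩ := h P _ _ inferInstance (LinearMap.ker π)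
  let g : A →ₗ[R] P := (LinearMap.ker π).subtype ∘ₗ e.symm.toLinearMap ∘ₗ f.rangeRestrict
  have hff (x : A) : f (f x) = 0 := by
    rw [← LinearMap.mem_ker, ← hf]; exact LinearMap.mem_range_self f x
  have hfx {x : A} (hx : f x = 0) : ∃ y, f y = x := by
    rw [← LinearMap.mem_ker, ← hf] at hx; exact hx
  have hg0 (x : A) : g x = 0 ↔ f x = 0 := by
    simp [g, Subtype.ext_iff]
  have hgπ (b : P) : π b = 0 ↔ ∃ x, g x = b := by
    constructor
    · intro hb
      obtain ⟨x, hx⟩ := f.surjective_rangeRestrict (e ⟨b, hb⟩)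
      exact ⟨x, by simp [g, hx]⟩
    · rintro ⟨x, rfl⟩
      exact (e.symm (f.rangeRestrict x)).2
  obtain ⟨s, hs⟩ := hext P _ _ inferInstance g (LinearMap.ext fun x => (hg0 _).2 (hff x))
  have hsg (x : A) : s (f x) = g x := LinearMap.congr_fun hs x
  let k : A →ₗ[R] P × P := s.prod g
  let q := (LinearMap.range k).mkQ
  have hq (b : P × P) : q b = 0 ↔ ∃ x, k x = b := by
    simp [q]
  have hi : LinearMap.ker π ≤ LinearMap.ker (q ∘ₗ LinearMap.inl R P P) := by
    intro b hb
    obtain ⟨r, rfl⟩ := (hgπ b).1 hb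
    exact (hq _).2 ⟨f r, Prod.ext (hsg r) ((hg0 _).2 (hff r))⟩
  have hp : LinearMap.range k ≤ LinearMap.ker (π ∘ₗ LinearMap.snd R P P) := by
    rintro _ ⟨x, rfl⟩
    exact (hgπ _).2 ⟨x, rfl⟩
  let i : N →ₗ[R] (P × P) ⧸ LinearMap.range k :=
    (LinearMap.ker π).liftQ _ hi ∘ₗ (π.quotKerEquivOfSurjective hπ).symm.toLinearMap
  have hiπ (b : P) : i (π b) = q (b, 0) := by
    have : (π.quotKerEquivOfSurjective hπ).symm (π b) = (LinearMap.ker π).mkQ b := by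
      rw [LinearEquiv.symm_apply_eq]; rfl
    simp only [i, LinearMap.comp_apply, LinearEquiv.coe_coe, this]
    rfl
  let p := (LinearMap.range k).liftQ _ hp
  have hpq (b : P × P) : p (q b) = π b.2 := rfl
  refine ⟨A, P × P, _, _, _, _, _, _, _, k, q, i, p, hA, inferInstance, ?_,
    LinearMap.exact_map_mkQ_range k, Submodule.mkQ_surjective _, ?_, ?_, ?_⟩
  · rw [injective_iff_map_eq_zero]
    intro x hx
    obtain ⟨r, rfl⟩ := hfx ((hg0 x).1 (congrArg Prod.snd hx))
    exact (hg0 r).1 ((hsg r).symm.trans (congrArg Prod.fst hx))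
  · rw [injective_iff_map_eq_zero]
    intro n hn
    obtain ⟨b, rfl⟩ := hπ n
    rw [hiπ, hq] at hn
    obtain ⟨x, hx⟩ := hn
    obtain ⟨r, rfl⟩ := hfx ((hg0 x).1 (congrArg Prod.snd hx))
    exact (hgπ b).2 ⟨r, (hsg r).symm.trans (congrArg Prod.fst hx)⟩
  · intro y
    obtain ⟨⟨a, b⟩, rfl⟩ := Submodule.mkQ_surjective _ y
    constructor
    · intro hy
      obtain ⟨x, rfl⟩ := (hgπ b).1 hy
      refine ⟨π (a - s x), ?_⟩
      rw [hiπ]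
      refine sub_eq_zero.1 ((map_sub q _ _).symm.trans ((hq _).2 ⟨-x, ?_⟩))
      simp [k]
    · rintro ⟨n, hn⟩
      obtain ⟨c, rfl⟩ := hπ n
      rw [← hn, hiπ, hpq, map_zero]
  · intro n
    obtain ⟨b, rfl⟩ := hπ n
    exact ⟨q (0, b), rfl⟩

/-- Strongly Gorenstein hereditary rings are coherent. -/
theorem IsSGHereditaryRing.isCoherentRing {R : Type u} [CommRing R]
    (h : IsSGHereditaryRing R) : IsCoherentRing R := by
  intro I hI
  obtain ⟨P, _, _, f, _, hf, ⟨e⟩, -⟩ := h R _ _ inferInstance I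
  have : Module.Finite R I := Module.Finite.iff_fg.2 hI
  have hfin : Module.Finite R (LinearMap.range f) := Module.Finite.equiv e
  have hker : (LinearMap.ker f).FG := hf ▸ Module.Finite.iff_fg.1 hfin
  have : Module.Finite R P := by
    refine ⟨Submodule.fg_of_fg_map_of_fg_inf_ker f ?_ ?_⟩
    · rw [Submodule.map_top]; exact Module.Finite.iff_fg.1 hfin
    · rwa [top_inf_eq]
  have : Module.FinitePresentation R P := Module.finitePresentation_of_projective R P
  have : Module.FinitePresentation R (LinearMap.range f) :=
    Module.finitePresentation_of_surjective f.rangeRestrict f.surjective_rangeRestrict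
      (by rwa [LinearMap.ker_rangeRestrict])
  have : Module.FinitePresentation R I := Module.FinitePresentation.of_equiv e.symm
  obtain ⟨n, g, hg⟩ := Module.Finite.exists_fin' R I
  exact ⟨n, g, hg, Module.FinitePresentation.fg_ker g hg⟩

/-- Remark 3.2(ii): every strongly Gorenstein hereditary ring is strongly Gorenstein
semihereditary. -/
theorem statement_10 (R : Type u) [CommRing R] (h : IsSGHereditaryRing R) :
    IsSGSemihereditaryRing R := by
  refine ⟨h.isCoherentRing, fun F _ _ _ N => ?_⟩
  obtain ⟨A, B, E, _, _, _, _, _, _, k, q, i, p, _, _, hk, hkq, hq, hi, hip, hp⟩ :=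
    h.exists_self_extension N
  have hflat : Module.Flat R E := by
    refine flat_of_rTensor_injective hkq hq fun X _ _ => ?_
    obtain ⟨A', B', W, _, _, _, _, _, _, k', q', j, -, _, _, hk', hkq', hq', hj, -, -⟩ :=
      h.exists_self_extension X
    have hN := lTensor_injective_of_injective_to_flat hk' N.subtype_injective
    have hW : Function.Injective (k.rTensor W) :=
      rTensor_injective_of_lTensor_injective hkq hq hkq' hq'
        (Module.Flat.rTensor_preserves_injective_linearMap k hk)
        (lTensor_injective_of_extension hi hip hp hN hN)
    have hcomp : Function.Injective (j.lTensor B ∘ₗ k.rTensor X) := by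
      rw [LinearMap.lTensor_comp_rTensor, ← LinearMap.rTensor_comp_lTensor]
      exact hW.comp (Module.Flat.lTensor_preserves_injective_linearMap j hj)
    exact Function.Injective.of_comp hcomp
  refine ⟨E, _, _, i ∘ₗ p, hflat, ?_, ⟨?_⟩, fun I _ _ _ => ?_⟩
  · rw [LinearMap.range_comp_of_range_eq_top i (LinearMap.range_eq_top.2 hp),
      LinearMap.ker_comp_of_ker_eq_bot p (LinearMap.ker_eq_bot.2 hi),
      LinearMap.exact_iff.1 hip]
  · exact (LinearEquiv.ofInjective i hi).trans (LinearEquiv.ofEq _ _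
      (LinearMap.range_comp_of_range_eq_top i (LinearMap.range_eq_top.2 hp)).symm)
  · obtain ⟨A', B', W, _, _, _, _, _, _, k', q', j, -, _, _, hk', hkq', hq', hj, -, -⟩ :=
      h.exists_self_extension I
    have hiW : Function.Injective (i.rTensor W) :=
      rTensor_injective_of_lTensor_injective hip hp hkq' hq'
        (Module.Flat.rTensor_preserves_injective_linearMap i hi)
        (lTensor_injective_of_injective_to_flat hk' N.subtype_injective)
    obtain ⟨r, hr⟩ := Module.Injective.out j hj (LinearMap.id : I →ₗ[R] I)
    have hjN : Function.Injective (j.lTensor N) := by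
      refine Function.HasLeftInverse.injective ⟨r.lTensor N, fun x => ?_⟩
      have hrj : r ∘ₗ j = LinearMap.id := LinearMap.ext hr
      rw [← LinearMap.comp_apply, ← LinearMap.lTensor_comp, hrj, LinearMap.lTensor_id_apply]
    have hiI : Function.Injective (i.rTensor I) := by
      have hcomp : Function.Injective (j.lTensor E ∘ₗ i.rTensor I) := by
        rw [LinearMap.lTensor_comp_rTensor, ← LinearMap.rTensor_comp_lTensor]
        exact hiW.comp hjN
      exact Function.Injective.of_comp hcomp
    rw [LinearMap.rTensor_comp,
      LinearMap.range_comp_of_range_eq_top _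
        (LinearMap.range_eq_top.2 (LinearMap.rTensor_surjective I hp)),
      LinearMap.ker_comp_of_ker_eq_bot _ (LinearMap.ker_eq_bot.2 hiI),
      LinearMap.exact_iff.1 (rTensor_exact I hip hp)]
end
end

section
/- Every Noetherian Gorenstein semihereditary commutative ring is Gorenstein hereditary; that is, if R is Noetherian, coherent, and every submodule of a flat R-module is Gorenstein flat, then every submodule of a projective R-module is Gorenstein projective. -/
noncomputable section

universe u

variable (R : Type u) [CommRing R]

namespace GorensteinHereditary

open TensorProduct

section

variable {R}

/-- `TorOneVanishes R M E` expresses `Tor₁(M, E) = 0`: tensoring with `M` preserves the kernel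
of every surjection onto `E`. -/
def TorOneVanishes (R : Type u) [CommRing R] (M E : Type u) [AddCommGroup M] [Module R M]
    [AddCommGroup E] [Module R E] : Prop :=
  ∀ (P : Type u) (_ : AddCommGroup P) (_ : Module R P) (p : P →ₗ[R] E),
    Function.Surjective p → Function.Injective ((LinearMap.ker p).subtype.lTensor M)

/-- `TorOneVanishes` may be tested on a single flat cover of the first argument. -/
theorem torOneVanishes_of_flat_cover {M E F : Type u} [AddCommGroup M] [Module R M]
    [AddCommGroup E] [Module R E] [AddCommGroup F] [Module R F] [Module.Flat R F]
    (g : F →ₗ[R] M) (hg : Function.Surjective g)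
    (h : Function.Injective ((LinearMap.ker g).subtype.rTensor E)) :
    TorOneVanishes R M E := by
  intro P _ _ p hp
  rw [injective_iff_map_eq_zero]
  intro t ht
  obtain ⟨u, rfl⟩ := LinearMap.rTensor_surjective (LinearMap.ker p) hg t
  have hu : g.rTensor P ((LinearMap.ker p).subtype.lTensor F u) = 0 := by
    rw [← LinearMap.comp_apply, LinearMap.rTensor_comp_lTensor,
      ← LinearMap.lTensor_comp_rTensor]
    exact ht
  obtain ⟨v, hv⟩ := (rTensor_exact P (LinearMap.exact_subtype_ker_map g) hg _).mp hu
  have hpv : p.lTensor (LinearMap.ker g) v = 0 := by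
    apply h
    rw [map_zero, ← LinearMap.comp_apply, LinearMap.rTensor_comp_lTensor,
      ← LinearMap.lTensor_comp_rTensor, LinearMap.comp_apply, hv, ← LinearMap.comp_apply,
      ← LinearMap.lTensor_comp]
    simp [LinearMap.comp_ker_subtype]
  obtain ⟨w, rfl⟩ :=
    (lTensor_exact (LinearMap.ker g) (LinearMap.exact_subtype_ker_map p) hp _).mp hpv
  have hw : (LinearMap.ker g).subtype.rTensor (LinearMap.ker p) w = u := by
    apply Module.Flat.lTensor_preserves_injective_linearMap (M := F)
      (LinearMap.ker p).subtype (Submodule.subtype_injective _)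
    rw [← hv, ← LinearMap.comp_apply, ← LinearMap.comp_apply, LinearMap.rTensor_comp_lTensor,
      LinearMap.lTensor_comp_rTensor]
  rw [← hw, ← LinearMap.comp_apply, ← LinearMap.rTensor_comp]
  simp [LinearMap.comp_ker_subtype]

theorem TorOneVanishes.symm {M E : Type u} [AddCommGroup M] [Module R M]
    [AddCommGroup E] [Module R E] (h : TorOneVanishes R M E) : TorOneVanishes R E M := by
  have hs := Finsupp.linearCombination_id_surjective R E
  exact torOneVanishes_of_flat_cover _ hs
    ((LinearMap.lTensor_inj_iff_rTensor_inj _ _).mp (h _ _ _ _ hs))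

theorem torOneVanishes_of_flat_right {M E : Type u} [AddCommGroup M] [Module R M]
    [AddCommGroup E] [Module R E] [Module.Flat R E] : TorOneVanishes R M E :=
  TorOneVanishes.symm fun _ _ _ _ _ ↦
    Module.Flat.lTensor_preserves_injective_linearMap _ (Submodule.subtype_injective _)

/-- The kernel of a surjection from a flat module onto `E` is flat as soon as
`Tor₁(J, E) = 0` for all ideals `J`. -/
theorem flat_ker {P E : Type u} [AddCommGroup P] [Module R P] [Module.Flat R P]
    [AddCommGroup E] [Module R E] (p : P →ₗ[R] E) (hp : Function.Surjective p)
    (h : ∀ J : Ideal R, TorOneVanishes R J E) : Module.Flat R (LinearMap.ker p) := by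
  rw [Module.Flat.iff_rTensor_injective]
  intro J _
  have hcomp : Function.Injective
      ((J.subtype.rTensor P) ∘ₗ ((LinearMap.ker p).subtype.lTensor J)) :=
    (Module.Flat.rTensor_preserves_injective_linearMap (M := P) J.subtype
      (Submodule.subtype_injective _)).comp (h J _ _ _ p hp)
  rw [LinearMap.rTensor_comp_lTensor, ← LinearMap.lTensor_comp_rTensor] at hcomp
  exact Function.Injective.of_comp hcomp

theorem flat_ker_of_flat {P E : Type u} [AddCommGroup P] [Module R P] [Module.Flat R P]
    [AddCommGroup E] [Module R E] [Module.Flat R E] (p : P →ₗ[R] E)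
    (hp : Function.Surjective p) : Module.Flat R (LinearMap.ker p) :=
  flat_ker p hp fun _ ↦ torOneVanishes_of_flat_right

theorem rTensor_ker_subtype_injective {A B C D : Type u} (E : Type u) [AddCommGroup A]
    [Module R A] [AddCommGroup B] [Module R B] [AddCommGroup C] [Module R C] [AddCommGroup D]
    [Module R D] [AddCommGroup E] [Module R E] (a : A →ₗ[R] B) (b : B →ₗ[R] C) (c : C →ₗ[R] D)
    (hab : b ∘ₗ a = 0) (hbc : LinearMap.range b = LinearMap.ker c)
    (hE : LinearMap.range (a.rTensor E) = LinearMap.ker (b.rTensor E)) :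
    Function.Injective ((LinearMap.ker c).subtype.rTensor E) := by
  let b' : B →ₗ[R] LinearMap.ker c := b.codRestrict _ fun x ↦ hbc ▸ LinearMap.mem_range_self b x
  have hb' : Function.Surjective b' := by
    rintro ⟨x, hx⟩
    obtain ⟨y, rfl⟩ : x ∈ LinearMap.range b := hbc ▸ hx
    exact ⟨y, rfl⟩
  have hsub : (LinearMap.ker c).subtype ∘ₗ b' = b := rfl
  have hb'a : b' ∘ₗ a = 0 := by
    ext x
    exact LinearMap.congr_fun hab x
  rw [injective_iff_map_eq_zero]
  intro t ht
  obtain ⟨y, rfl⟩ := LinearMap.rTensor_surjective E hb' t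
  rw [← LinearMap.comp_apply, ← LinearMap.rTensor_comp, hsub, ← LinearMap.mem_ker, ← hE] at ht
  obtain ⟨z, rfl⟩ := ht
  rw [← LinearMap.comp_apply, ← LinearMap.rTensor_comp, hb'a]
  simp

theorem torOneVanishes_of_linearEquiv {M N E : Type u} [AddCommGroup M] [Module R M]
    [AddCommGroup N] [Module R N] [AddCommGroup E] [Module R E] (e : M ≃ₗ[R] N)
    (h : TorOneVanishes R N E) : TorOneVanishes R M E := by
  intro P _ _ p hp
  have hcomp : Function.Injective
      (((LinearMap.ker p).subtype.lTensor N) ∘ₗ (e.toLinearMap.rTensor (LinearMap.ker p))) :=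
    (h P _ _ p hp).comp (e.rTensor (LinearMap.ker p)).injective
  rw [LinearMap.lTensor_comp_rTensor, ← LinearMap.rTensor_comp_lTensor] at hcomp
  exact Function.Injective.of_comp hcomp

theorem torOneVanishes_of_gorensteinFlat {M E : Type u} [AddCommGroup M] [Module R M]
    [AddCommGroup E] [Module R E] (hE : Module.Injective R E) (hM : IsGorensteinFlat R M) :
    TorOneVanishes R M E := by
  obtain ⟨F, _, _, d, hF, hd, ⟨e⟩, hI⟩ := hM
  have key (j : ℤ) : TorOneVanishes R (LinearMap.range (d j)) E := by
    obtain ⟨i, rfl⟩ : ∃ i : ℤ, j = i + 1 + 1 := ⟨j - 2, by ring⟩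
    have := hF (i + 1 + 1)
    refine torOneVanishes_of_flat_cover _ (d (i + 1 + 1)).surjective_rangeRestrict ?_
    rw [LinearMap.ker_rangeRestrict]
    exact rTensor_ker_subtype_injective E (d i) (d (i + 1)) (d (i + 1 + 1))
      (LinearMap.range_le_ker_iff.mp (hd i).le) (hd (i + 1)) (hI E _ _ hE i)
  exact torOneVanishes_of_linearEquiv e (key 0)

theorem exists_injective_embedding (K : Type u) [AddCommGroup K] [Module R K] :
    ∃ (E : Type u) (_ : AddCommGroup E) (_ : Module R E) (i : K →ₗ[R] E),
      Module.Injective R E ∧ Function.Injective i := by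
  let E := CategoryTheory.Injective.under (ModuleCat.of R K)
  refine ⟨E, inferInstance, inferInstance,
    (CategoryTheory.Injective.ι (ModuleCat.of R K)).hom, ?_, ?_⟩
  · have : CategoryTheory.Injective (ModuleCat.of R E) :=
      inferInstanceAs (CategoryTheory.Injective E)
    exact Module.injective_module_of_injective_object R E
  · rw [← ModuleCat.mono_iff_injective]
    infer_instance

/-- A functional on a submodule `L` of `Rⁿ` extends to `Rⁿ` if `L ⊗ E → Rⁿ ⊗ E` is injective for
every injective `E`. -/
theorem exists_extend_dual {n : ℕ} (L : Submodule R (Fin n → R)) [Module.Finite R L]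
    (hL : ∀ (E : Type u) (_ : AddCommGroup E) (_ : Module R E), Module.Injective R E →
      Function.Injective (L.subtype.rTensor E)) (φ : L →ₗ[R] R) :
    ∃ f : (Fin n → R) →ₗ[R] R, f ∘ₗ L.subtype = φ := by
  let res := LinearMap.lcomp R R L.subtype
  obtain ⟨E, _, _, j, hE, hj⟩ := exists_injective_embedding (R := R) (_ ⧸ LinearMap.range res)
  let ψ := j ∘ₗ (LinearMap.range res).mkQ
  have hψ (f : (Fin n → R) →ₗ[R] R) : ψ (f ∘ₗ L.subtype) = 0 := by
    have : (LinearMap.range res).mkQ (f ∘ₗ L.subtype) = 0 :=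
      (Submodule.Quotient.mk_eq_zero _).mpr ⟨f, rfl⟩
    rw [LinearMap.comp_apply, this, map_zero]
  obtain ⟨m, s, hs⟩ := Module.Finite.exists_fin' R L
  let ev : (L →ₗ[R] R) →ₗ[R] (Fin m → R) :=
    LinearMap.pi fun i ↦ LinearMap.applyₗ (s (Pi.single i 1))
  have hev : Function.Injective ev := by
    intro f g hfg
    rw [← LinearMap.cancel_right hs]
    ext i
    simpa [ev] using congrFun hfg i
  obtain ⟨Ψ, hΨ⟩ := Module.Injective.extension_property R E _ _ ev hev ψ
  have hψ_eq (f : L →ₗ[R] R) :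
      ψ f = ∑ i, f (s (Pi.single i 1)) • Ψ (Pi.single i 1) := by
    rw [← hΨ, LinearMap.comp_apply, pi_eq_sum_univ' (ev f), map_sum]
    simp [ev]
  let t : L ⊗[R] E := ∑ i, s (Pi.single i 1) ⊗ₜ Ψ (Pi.single i 1)
  have ht : t = 0 := by
    apply hL E _ _ hE
    have hcoord (x : L) (y : E) :
        x.1 ⊗ₜ[R] y = ∑ k, (Pi.single k 1 : Fin n → R) ⊗ₜ[R] (x.1 k • y) := by
      conv_lhs => rw [pi_eq_sum_univ' x.1]
      simp only [TensorProduct.sum_tmul, TensorProduct.smul_tmul]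
    simp only [t, map_sum, map_zero, LinearMap.rTensor_tmul, Submodule.subtype_apply]
    simp_rw [hcoord]
    rw [Finset.sum_comm]
    refine Finset.sum_eq_zero fun k _ ↦ ?_
    rw [← TensorProduct.tmul_sum]
    have := hψ (LinearMap.proj k)
    rw [hψ_eq] at this
    simp only [LinearMap.comp_apply, Submodule.subtype_apply, LinearMap.proj_apply] at this
    rw [this, TensorProduct.tmul_zero]
  have hφ : ψ φ = 0 := by
    have := congrArg ((TensorProduct.lid R E).toLinearMap ∘ₗ φ.rTensor E) ht
    rw [hψ_eq]
    simpa [t] using this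
  have : (LinearMap.range res).mkQ φ = 0 := hj (by simpa [ψ] using hφ)
  exact (Submodule.Quotient.mk_eq_zero _).mp this

theorem exists_extend_flat [IsNoetherianRing R] {n : ℕ} (L : Submodule R (Fin n → R))
    (hL : ∀ (E : Type u) (_ : AddCommGroup E) (_ : Module R E), Module.Injective R E →
      Function.Injective (L.subtype.rTensor E)) {K : Type u} [AddCommGroup K] [Module R K]
    [Module.Flat R K] (φ : L →ₗ[R] K) : ∃ f : (Fin n → R) →ₗ[R] K, f ∘ₗ L.subtype = φ := by
  have := Module.finitePresentation_of_finite R L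
  obtain ⟨k, α, β, rfl⟩ := Module.Flat.exists_factorization_of_finitePresentation φ
  choose f hf using fun i ↦ exists_extend_dual L hL (Finsupp.lapply i ∘ₗ α)
  refine ⟨β ∘ₗ (Finsupp.linearEquivFunOnFinite R R (Fin k)).symm.toLinearMap ∘ₗ
    LinearMap.pi f, ?_⟩
  ext x
  simp only [LinearMap.comp_apply]
  congr 1
  ext i
  exact LinearMap.congr_fun (hf i) x

/-- Injective modules have flat dimension at most one, expressed by the vanishing of
`Tor₂(R ⧸ J, E) = Tor₁(J, E)`. -/
def InjectivesHaveFlatDimLEOne (R : Type u) [CommRing R] : Prop :=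
  ∀ (J : Ideal R) (E : Type u) (_ : AddCommGroup E) (_ : Module R E), Module.Injective R E →
    TorOneVanishes R J E

/-- If injective modules have flat dimension at most one, the quotient of an injective module by
a flat submodule is injective. -/
theorem injective_of_flat_ker [IsNoetherianRing R] (hR : InjectivesHaveFlatDimLEOne R)
    {E E' : Type u} [AddCommGroup E] [Module R E] [AddCommGroup E'] [Module R E']
    [Module.Injective R E] (π : E →ₗ[R] E') (hπ : Function.Surjective π)
    [Module.Flat R (LinearMap.ker π)] : Module.Injective R E' := by
  refine Module.Baer.injective fun J g ↦ ?_
  obtain ⟨n, s, hs⟩ := Module.Finite.exists_fin' R J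
  obtain ⟨a, ha⟩ := Module.projective_lifting_property π (g ∘ₗ s) hπ
  have hker (x : LinearMap.ker s) : a x ∈ LinearMap.ker π := by
    rw [LinearMap.mem_ker, ← LinearMap.comp_apply, ha, LinearMap.comp_apply, x.2, map_zero]
  obtain ⟨b, hb⟩ := exists_extend_flat (LinearMap.ker s)
    (fun E _ _ hE ↦ (LinearMap.lTensor_inj_iff_rTensor_inj _ _).mp
      ((hR J E _ _ hE).symm _ _ _ s hs))
    ((a ∘ₗ (LinearMap.ker s).subtype).codRestrict _ hker)
  obtain ⟨c, hc⟩ := (LinearMap.exact_lcomp_of_exact_of_surjective E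
    (LinearMap.exact_subtype_ker_map s) hs (a - (LinearMap.ker π).subtype ∘ₗ b)).mp (by
      ext x
      have hbx : (b x : E) = a x := congrArg Subtype.val (LinearMap.congr_fun hb x)
      simp [hbx])
  obtain ⟨c', hc'⟩ := Module.Injective.extension_property R E _ _ J.subtype
    (Submodule.subtype_injective _) c
  refine ⟨π ∘ₗ c', fun x hx ↦ ?_⟩
  obtain ⟨y, hy⟩ := hs ⟨x, hx⟩
  have h₁ : c' x = c ⟨x, hx⟩ := LinearMap.congr_fun hc' ⟨x, hx⟩
  have h₂ : c (s y) = a y - b y := LinearMap.congr_fun hc y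
  have h₃ : π (a y) = g (s y) := LinearMap.congr_fun ha y
  rw [LinearMap.comp_apply, h₁, ← hy, h₂, map_sub, h₃, LinearMap.mem_ker.mp (b y).2, sub_zero]

/-- Maps into a flat module extend along an embedding whose cokernel embeds into a projective
module. -/
theorem exists_extend_of_exact [IsNoetherianRing R] (hR : InjectivesHaveFlatDimLEOne R)
    {X Y P Q : Type u} [AddCommGroup X] [Module R X] [AddCommGroup Y] [Module R Y]
    [AddCommGroup P] [Module R P] [Module.Projective R P] [AddCommGroup Q] [Module R Q]
    [Module.Flat R Q] (i : X →ₗ[R] Y) (hi : Function.Injective i) (q : Y →ₗ[R] P)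
    (hiq : Function.Exact i q) (φ : X →ₗ[R] Q) : ∃ f : Y →ₗ[R] Q, f ∘ₗ i = φ := by
  obtain ⟨E, _, _, j, hE, hj⟩ := exists_injective_embedding (R := R) Q
  let π := (LinearMap.range j).mkQ
  have hπ : Function.Surjective π := Submodule.mkQ_surjective _
  have hjπ : Function.Exact j π := LinearMap.exact_iff.mpr (Submodule.ker_mkQ _)
  have : Module.Flat R (LinearMap.ker π) := Module.Flat.of_linearEquiv
    ((LinearEquiv.ofEq _ _ (LinearMap.exact_iff.mp hjπ)).trans
      (LinearEquiv.ofInjective j hj).symm)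
  have := injective_of_flat_ker hR π hπ
  obtain ⟨e, he⟩ := Module.Injective.extension_property R E _ _ i hi (j ∘ₗ φ)
  have hiq' : Function.Exact i q.rangeRestrict := fun y ↦ by
    rw [← hiq y, Subtype.ext_iff]
    rfl
  obtain ⟨g, hg⟩ := (LinearMap.exact_lcomp_of_exact_of_surjective _ hiq' q.surjective_rangeRestrict (π ∘ₗ e)).mp (by
      ext x
      have h₁ : e (i x) = j (φ x) := LinearMap.congr_fun he x
      have h₂ := hjπ.apply_apply_eq_zero (φ x)
      simpa [h₁] using h₂)
  obtain ⟨g', hg'⟩ := Module.Injective.extension_property R _ _ _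
    (LinearMap.range q).subtype (Submodule.subtype_injective _) g
  obtain ⟨γ, hγ⟩ := Module.projective_lifting_property π g' hπ
  have hmem (y : Y) : (e - γ ∘ₗ q) y ∈ LinearMap.range j := by
    refine (hjπ _).mp ?_
    have h₁ : π (γ (q y)) = g' (q y) := LinearMap.congr_fun hγ (q y)
    have h₂ : g' (q y) = g (q.rangeRestrict y) := LinearMap.congr_fun hg' (q.rangeRestrict y)
    have h₃ : g (q.rangeRestrict y) = π (e y) := LinearMap.congr_fun hg y
    simp only [LinearMap.sub_apply, LinearMap.comp_apply, map_sub, h₁, h₂, h₃, sub_self]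
  refine ⟨(LinearEquiv.ofInjective j hj).symm.toLinearMap ∘ₗ
    (e - γ ∘ₗ q).codRestrict _ hmem, ?_⟩
  ext x
  simp only [LinearMap.comp_apply, LinearEquiv.coe_coe, LinearEquiv.symm_apply_eq]
  ext
  have h₁ : e (i x) = j (φ x) := LinearMap.congr_fun he x
  simp [h₁, hiq.apply_apply_eq_zero x]

/-- A module that embeds into a projective module. -/
def EmbedsIntoProjective (R : Type u) [CommRing R] (M : Type u) [AddCommGroup M] [Module R M] :
    Prop :=
  ∃ (P : Type u) (_ : AddCommGroup P) (_ : Module R P) (i : M →ₗ[R] P),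
    Module.Projective R P ∧ Function.Injective i

theorem projective_of_flat_ker [IsNoetherianRing R] (hR : InjectivesHaveFlatDimLEOne R)
    {A Y : Type u} [AddCommGroup A] [Module R A] [Module.Projective R A]
    [AddCommGroup Y] [Module R Y] (hY : EmbedsIntoProjective R Y) (g : A →ₗ[R] Y)
    (hg : Function.Surjective g) [Module.Flat R (LinearMap.ker g)] : Module.Projective R Y := by
  obtain ⟨P, _, _, i, _, hi⟩ := hY
  have hex := LinearMap.exact_subtype_ker_map g
  have hinj := Submodule.subtype_injective (LinearMap.ker g)
  have hretract := exists_extend_of_exact hR _ hinj (i ∘ₗ g)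
    (hex.comp_injective i hi (map_zero i)) LinearMap.id
  obtain ⟨l, hl⟩ := ((hex.split_tfae hinj hg).out 1 0).mp hretract
  exact Module.Projective.of_split l g hl

/-- The middle term of an extension of `E` by a flat module is projective if it embeds into a
projective module and `Tor₁(J, E) = 0` for all ideals `J`. -/
theorem projective_of_surjective_of_flat_ker [IsNoetherianRing R]
    (hR : InjectivesHaveFlatDimLEOne R) {Y E : Type u} [AddCommGroup Y] [Module R Y]
    [AddCommGroup E] [Module R E] (hY : EmbedsIntoProjective R Y)
    (hE : ∀ J : Ideal R, TorOneVanishes R J E) (r : Y →ₗ[R] E) (hr : Function.Surjective r)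
    [Module.Flat R (LinearMap.ker r)] : Module.Projective R Y := by
  let g := Finsupp.linearCombination R (id : Y → Y)
  have hg : Function.Surjective g := Finsupp.linearCombination_id_surjective R Y
  have := flat_ker (r ∘ₗ g) (hr.comp hg) hE
  let g' : LinearMap.ker (r ∘ₗ g) →ₗ[R] LinearMap.ker r := g.restrict fun _ hx ↦ hx
  have hg' : Function.Surjective g' := by
    rintro ⟨y, hy⟩
    obtain ⟨x, rfl⟩ := hg y
    exact ⟨⟨x, hy⟩, rfl⟩
  have := flat_ker_of_flat (P := LinearMap.ker (r ∘ₗ g)) g' hg'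
  let e : LinearMap.ker g ≃ₗ[R] LinearMap.ker g' :=
    { toFun := fun x ↦ ⟨⟨x.1, by simp [LinearMap.mem_ker.mp x.2]⟩, Subtype.ext x.2⟩
      invFun := fun x ↦ ⟨x.1.1, congrArg Subtype.val x.2⟩
      map_add' := fun _ _ ↦ rfl
      map_smul' := fun _ _ ↦ rfl
      left_inv := fun _ ↦ rfl
      right_inv := fun _ ↦ rfl }
  have := Module.Flat.of_linearEquiv e
  exact projective_of_flat_ker hR hY g hg

theorem EmbedsIntoProjective.of_exact [IsNoetherianRing R] (hR : InjectivesHaveFlatDimLEOne R)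
    {X Y P : Type u} [AddCommGroup X] [Module R X] [AddCommGroup Y] [Module R Y]
    [AddCommGroup P] [Module R P] [Module.Projective R P] (hX : EmbedsIntoProjective R X)
    (i : X →ₗ[R] Y) (hi : Function.Injective i) (q : Y →ₗ[R] P) (hiq : Function.Exact i q) :
    EmbedsIntoProjective R Y := by
  obtain ⟨P₀, _, _, k, _, hk⟩ := hX
  obtain ⟨f, hf⟩ := exists_extend_of_exact hR i hi q hiq k
  refine ⟨P₀ × P, inferInstance, inferInstance, f.prod q, inferInstance, ?_⟩
  rw [injective_iff_map_eq_zero]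
  intro y hy
  obtain ⟨hy₁, hy₂⟩ := Prod.ext_iff.mp hy
  obtain ⟨x, rfl⟩ := (hiq y).mp hy₂
  have hx : k x = 0 := (LinearMap.congr_fun hf x).symm.trans hy₁
  rw [(injective_iff_map_eq_zero k).mp hk x hx, map_zero]

/-- `IsSyzygyStep R M N` : there is a short exact sequence `0 → M → P → N → 0` with `P`
projective. -/
def IsSyzygyStep (R : Type u) [CommRing R] (M N : Type u) [AddCommGroup M] [Module R M]
    [AddCommGroup N] [Module R N] : Prop :=
  ∃ (P : Type u) (_ : AddCommGroup P) (_ : Module R P) (f : M →ₗ[R] P) (g : P →ₗ[R] N),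
    Module.Projective R P ∧ Function.Injective f ∧ Function.Surjective g ∧ Function.Exact f g

theorem exists_isSyzygyStep_left (M : Type u) [AddCommGroup M] [Module R M] :
    ∃ (N : Type u) (_ : AddCommGroup N) (_ : Module R N),
      EmbedsIntoProjective R N ∧ IsSyzygyStep R N M :=
  ⟨LinearMap.ker (Finsupp.linearCombination R (id : M → M)), inferInstance, inferInstance,
    ⟨_, _, _, Submodule.subtype _, inferInstance, Submodule.subtype_injective _⟩,
    ⟨_, _, _, Submodule.subtype _, _, inferInstance, Submodule.subtype_injective _,
      Finsupp.linearCombination_id_surjective R M, LinearMap.exact_subtype_ker_map _⟩⟩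

theorem exists_isSyzygyStep_right [IsNoetherianRing R] (hR : InjectivesHaveFlatDimLEOne R)
    {M : Type u} [AddCommGroup M] [Module R M] (hM : EmbedsIntoProjective R M) :
    ∃ (N : Type u) (_ : AddCommGroup N) (_ : Module R N),
      EmbedsIntoProjective R N ∧ IsSyzygyStep R M N := by
  obtain ⟨E, _, _, j, hE, hj⟩ := exists_injective_embedding (R := R) M
  obtain ⟨E', _, _, j', hE', hj'⟩ := exists_injective_embedding (R := R) (E ⧸ LinearMap.range j)
  let f : E →ₗ[R] E' := j' ∘ₗ (LinearMap.range j).mkQ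
  have hj_mkQ : Function.Exact j (LinearMap.range j).mkQ :=
    LinearMap.exact_iff.mpr (Submodule.ker_mkQ _)
  have hjf : Function.Exact j f := hj_mkQ.comp_injective j' hj' (map_zero j')
  let π := Finsupp.linearCombination R (id : E' → E')
  have hπ : Function.Surjective π := Finsupp.linearCombination_id_surjective R E'
  have := flat_ker π hπ fun J ↦ hR J E' _ _ hE'
  let Y := LinearMap.ker (f.coprod (-π))
  have mem_Y (x : E × (E' →₀ R)) : x ∈ Y ↔ f x.1 = π x.2 := by
    simp [Y, add_neg_eq_zero]
  let i : M →ₗ[R] Y := (LinearMap.inl R E _ ∘ₗ j).codRestrict _ fun x ↦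
    (mem_Y _).mpr (by simpa using hjf.apply_apply_eq_zero x)
  have hi : Function.Injective i := fun x y hxy ↦
    hj (congrArg (fun z : Y ↦ z.1.1) hxy)
  let q : Y →ₗ[R] (E' →₀ R) := LinearMap.snd R E _ ∘ₗ Y.subtype
  have hiq : Function.Exact i q := by
    rintro ⟨⟨e, p⟩, hy⟩
    constructor
    · rintro (rfl : p = 0)
      obtain ⟨x, rfl⟩ := (hjf e).mp (by simpa using (mem_Y _).mp hy)
      exact ⟨x, rfl⟩
    · rintro ⟨x, hx⟩
      exact (congrArg (fun z : Y ↦ z.1.2) hx).symm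
  let r : Y →ₗ[R] E := LinearMap.fst R E _ ∘ₗ Y.subtype
  have hr : Function.Surjective r := fun e ↦ by
    obtain ⟨p, hp⟩ := hπ (f e)
    exact ⟨⟨(e, p), (mem_Y _).mpr hp.symm⟩, rfl⟩
  let ε : LinearMap.ker r ≃ₗ[R] LinearMap.ker π :=
    { toFun := fun y ↦ ⟨y.1.1.2, by
        rw [LinearMap.mem_ker, ← (mem_Y _).mp y.1.2, show y.1.1.1 = 0 from y.2, map_zero]⟩
      invFun := fun p ↦ ⟨⟨(0, p.1), (mem_Y _).mpr (by
        rw [LinearMap.mem_ker.mp p.2, map_zero])⟩, rfl⟩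
      map_add' := fun _ _ ↦ rfl
      map_smul' := fun _ _ ↦ rfl
      left_inv := fun y ↦ Subtype.ext (Subtype.ext (Prod.ext y.2.symm rfl))
      right_inv := fun _ ↦ rfl }
  have := Module.Flat.of_linearEquiv ε
  have hY := projective_of_surjective_of_flat_ker (Y := Y) hR (hM.of_exact hR i hi q hiq)
    (fun J ↦ hR J E _ _ hE) r hr
  refine ⟨LinearMap.range q, inferInstance, inferInstance,
    ⟨_, _, _, Submodule.subtype _, inferInstance, Submodule.subtype_injective _⟩,
    ⟨Y, inferInstance, inferInstance, i, q.rangeRestrict, hY, hi,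
      q.surjective_rangeRestrict, fun y ↦ ?_⟩⟩
  rw [← hiq y, Subtype.ext_iff]
  rfl

theorem exists_int_chain {α : Type*} (r : α → α → Prop) (hnext : ∀ a, ∃ b, r a b)
    (hprev : ∀ a, ∃ b, r b a) (a : α) : ∃ s : ℤ → α, s 0 = a ∧ ∀ i, r (s i) (s (i + 1)) := by
  choose next hnext using hnext
  choose prev hprev using hprev
  let s : ℤ → α
    | Int.ofNat n => next^[n] a
    | Int.negSucc n => prev^[n + 1] a
  refine ⟨s, rfl, ?_⟩
  rintro (n | n | n)
  · change r (next^[n] a) (next^[n + 1] a)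
    rw [Function.iterate_succ_apply']
    exact hnext _
  · exact hprev a
  · change r (prev^[n + 1 + 1] a) (prev^[n + 1] a)
    rw [Function.iterate_succ_apply' prev (n + 1)]
    exact hprev _

theorem isGorensteinProjective_of_embedsIntoProjective [IsNoetherianRing R]
    (hR : InjectivesHaveFlatDimLEOne R) {M : Type u} [AddCommGroup M] [Module R M]
    (hM : EmbedsIntoProjective R M) : IsGorensteinProjective R M := by
  obtain ⟨s, hs₀, hs⟩ := exists_int_chain
    (fun A B : {N : ModuleCat.{u} R // EmbedsIntoProjective R N} ↦ IsSyzygyStep R A.1 B.1)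
    (fun A ↦ by
      obtain ⟨N, _, _, hN, hAN⟩ := exists_isSyzygyStep_right hR A.2
      exact ⟨⟨ModuleCat.of R N, hN⟩, hAN⟩)
    (fun A ↦ by
      obtain ⟨N, _, _, hN, hNA⟩ := exists_isSyzygyStep_left (R := R) A.1
      exact ⟨⟨ModuleCat.of R N, hN⟩, hNA⟩)
    ⟨ModuleCat.of R M, hM⟩
  let S (i : ℤ) : ModuleCat.{u} R := (s (i - 1)).1
  have hS (i : ℤ) : EmbedsIntoProjective R (S i) := (s (i - 1)).2
  have hS₁ : S 1 = ModuleCat.of R M := congrArg Subtype.val hs₀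
  have hstep (i : ℤ) : IsSyzygyStep R (S i) (S (i + 1)) := by
    have := hs (i - 1)
    rwa [sub_add_eq_add_sub] at this
  choose P _ _ f g hP hf hg hfg using hstep
  have hd (i : ℤ) : LinearMap.ker (f (i + 1) ∘ₗ g i) = LinearMap.range (f i) := by
    rw [LinearMap.ker_comp_of_ker_eq_bot _ (LinearMap.ker_eq_bot.mpr (hf _))]
    exact LinearMap.exact_iff.mp (hfg i)
  have hrange (i : ℤ) : LinearMap.range (f (i + 1) ∘ₗ g i) = LinearMap.range (f (i + 1)) :=
    LinearMap.range_comp_of_range_eq_top _ (LinearMap.range_eq_top.mpr (hg i))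
  refine ⟨P, inferInstance, inferInstance, fun i ↦ f (i + 1) ∘ₗ g i, hP,
    fun i ↦ (hrange i).trans (hd (i + 1)).symm, ?_, ?_⟩
  · rw [hrange]
    exact ⟨(CategoryTheory.eqToIso hS₁.symm).toLinearEquiv.trans
      (LinearEquiv.ofInjective (f 1) (hf 1))⟩
  · intro Q _ _ _ i φ hφ
    obtain ⟨ψ, rfl⟩ := (LinearMap.exact_lcomp_of_exact_of_surjective Q (hfg (i + 1))
      (hg (i + 1)) φ).mp ((LinearMap.cancel_right (hg i)).mp hφ)
    obtain ⟨P', _, _, k, _, hk⟩ := hS (i + 1 + 1 + 1)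
    obtain ⟨h, rfl⟩ := exists_extend_of_exact hR (f (i + 1 + 1)) (hf _) (k ∘ₗ g (i + 1 + 1))
      ((hfg _).comp_injective k hk (map_zero k)) ψ
    exact ⟨h, rfl⟩

end

end GorensteinHereditary

/-- Remark 3.2(iii): every Noetherian Gorenstein semihereditary ring is Gorenstein
hereditary. -/
theorem statement_11 (R : Type u) [CommRing R] (hN : IsNoetherianRing R)
    (h : IsGSemihereditaryRing R) :
    IsGHereditaryRing R := by
  have hR : GorensteinHereditary.InjectivesHaveFlatDimLEOne R := fun J E _ _ hE ↦
    GorensteinHereditary.torOneVanishes_of_gorensteinFlat hE (h.2 R _ _ inferInstance J)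
  exact fun P _ _ hP N ↦
    GorensteinHereditary.isGorensteinProjective_of_embedsIntoProjective hR
      ⟨P, _, _, N.subtype, hP, N.subtype_injective⟩
end
end

section
/- Every Noetherian strongly Gorenstein semihereditary commutative ring is strongly Gorenstein hereditary; that is, if R is Noetherian, coherent, and every submodule of a flat R-module is strongly Gorenstein flat, then every submodule of a projective R-module is strongly Gorenstein projective. -/
noncomputable section

universe u

variable (R : Type u) [CommRing R]

open TensorProduct

section

variable {R}

theorem rTensor_range_subtype_injective {F E : Type u} [AddCommGroup F] [Module R F]
    [AddCommGroup E] [Module R E] {f : F →ₗ[R] F} (hf : LinearMap.range f = LinearMap.ker f)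
    (hE : LinearMap.range (LinearMap.rTensor E f) = LinearMap.ker (LinearMap.rTensor E f)) :
    Function.Injective ((LinearMap.range f).subtype.rTensor E) := by
  rw [injective_iff_map_eq_zero]
  intro z hz
  obtain ⟨w, rfl⟩ := LinearMap.rTensor_surjective E f.surjective_rangeRestrict z
  have hw : w ∈ LinearMap.ker (LinearMap.rTensor E f) := by
    rw [LinearMap.mem_ker, ← hz, ← LinearMap.comp_apply, ← LinearMap.rTensor_comp]
    rfl
  rw [← hE] at hw
  obtain ⟨v, rfl⟩ := hw
  have h0 : f.rangeRestrict ∘ₗ f = 0 := by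
    ext x
    have : f x ∈ LinearMap.ker f := hf ▸ LinearMap.mem_range_self f x
    simpa using this
  rw [← LinearMap.comp_apply, ← LinearMap.rTensor_comp, h0]
  simp

/-- Injectivity after tensoring transfers from the kernel of one flat cover of a module to the
kernel of any projective cover of it. -/
theorem rTensor_ker_subtype_injective {F E B : Type u} [AddCommGroup F] [Module R F]
    [AddCommGroup E] [Module R E] [AddCommGroup B] [Module R B] [Module.Flat R F]
    [Module.Projective R B] {f : F →ₗ[R] F} (hf : LinearMap.range f = LinearMap.ker f)
    (hE : LinearMap.range (LinearMap.rTensor E f) = LinearMap.ker (LinearMap.rTensor E f))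
    (p : B →ₗ[R] LinearMap.range f) (hp : Function.Surjective p) :
    Function.Injective ((LinearMap.ker p).subtype.rTensor E) := by
  obtain ⟨α, hα⟩ := Module.projective_lifting_property f.rangeRestrict p f.surjective_rangeRestrict
  have hα' : ∀ b, f (α b) = p b := fun b => congrArg Subtype.val (LinearMap.congr_fun hα b)
  let α' : LinearMap.ker p →ₗ[R] LinearMap.range f :=
    (α ∘ₗ (LinearMap.ker p).subtype).codRestrict _ fun x => by
      refine hf.ge (LinearMap.mem_ker.2 ?_)
      simp [hα']
  let i : LinearMap.ker p →ₗ[R] B × LinearMap.range f :=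
    LinearMap.inl R _ _ ∘ₗ (LinearMap.ker p).subtype - LinearMap.inr R _ _ ∘ₗ α'
  let s : B × LinearMap.range f →ₗ[R] F := α.coprod (LinearMap.range f).subtype
  have hi1 : ∀ x, (i x).1 = x := fun x => by simp [i]
  have hi2 : ∀ x, (i x).2 = -α' x := fun x => by simp [i]
  have hs : ∀ x, s x = α x.1 + x.2 := fun x => by simp [s]
  have hff : ∀ y : LinearMap.range f, f y = 0 := fun y => hf.le y.2
  have hs_surj : Function.Surjective s := fun x => by
    obtain ⟨b, hb⟩ := hp (f.rangeRestrict x)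
    have hx : x - α b ∈ LinearMap.range f := by
      rw [hf, LinearMap.mem_ker, map_sub, hα', hb]
      simp
    exact ⟨(b, ⟨x - α b, hx⟩), by simp [hs]⟩
  have hi_inj : Function.Injective i := fun x y hxy => by
    apply Subtype.ext
    rw [← hi1 x, ← hi1 y, hxy]
  have hexact : Function.Exact i s := fun x => by
    constructor
    · intro hx
      rw [hs] at hx
      have hb : p x.1 = 0 := by
        apply Subtype.ext
        have := congrArg f hx
        rwa [map_add, hff, add_zero, hα', map_zero] at this
      refine ⟨⟨x.1, hb⟩, Prod.ext (hi1 _) ?_⟩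
      rw [hi2]
      apply Subtype.ext
      exact neg_eq_of_add_eq_zero_right hx
    · rintro ⟨y, rfl⟩
      rw [hs, hi1, hi2]
      simp [α']
  have key : Function.Injective (i.rTensor E) :=
    (i.lTensor_inj_iff_rTensor_inj E).1
      (LinearMap.lTensor_injective_of_exact_of_flat s hs_surj i hi_inj hexact E)
  rw [injective_iff_map_eq_zero]
  intro x hx
  have hx' : α'.rTensor E x = 0 := by
    apply rTensor_range_subtype_injective hf hE
    have hc : (LinearMap.range f).subtype ∘ₗ α' = α ∘ₗ (LinearMap.ker p).subtype := rfl
    rw [← LinearMap.comp_apply, ← LinearMap.rTensor_comp, hc, LinearMap.rTensor_comp,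
      LinearMap.comp_apply, hx, map_zero, map_zero]
  apply key
  simp only [i, LinearMap.rTensor_sub, LinearMap.rTensor_comp, LinearMap.sub_apply,
    LinearMap.comp_apply, hx, hx', map_zero, sub_zero]

/-- If a finitely generated submodule `L` of `Rⁿ` stays embedded after tensoring with the
character module of `K`, then every map `L → K` extends to `Rⁿ`. -/
theorem exists_extension_of_rTensor_characterModule_injective {K : Type u} [AddCommGroup K]
    [Module R K] {n : ℕ} (L : Submodule R (Fin n → R)) (hL : L.FG)
    (hinj : Function.Injective (L.subtype.rTensor (CharacterModule K))) (φ : L →ₗ[R] K) :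
    ∃ ψ : (Fin n → R) →ₗ[R] K, ψ ∘ₗ L.subtype = φ := by
  suffices Function.Surjective (L.subtype.lcomp R K) from this φ
  apply CharacterModule.surjective_of_dual_injective
  rw [injective_iff_map_eq_zero]
  intro ξ hξ
  have hL' : Module.Finite R L := Module.Finite.iff_fg.2 hL
  obtain ⟨m, s, hs⟩ := Module.Finite.exists_fin (R := R) (M := L)
  let ev : (L →ₗ[R] K) →ₗ[R] (Fin m → K) := LinearMap.pi fun j => LinearMap.applyₗ (s j)
  have hev : Function.Injective ev := fun a b hab => by
    apply LinearMap.ext_on_range hs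
    exact fun j => congrFun hab j
  obtain ⟨η, rfl⟩ := CharacterModule.dual_surjective_of_injective ev hev ξ
  let χ : Fin m → CharacterModule K := fun j =>
    CharacterModule.dual (LinearMap.single R (fun _ => K) j) η
  have hη : ∀ v, η v = ∑ j, χ j (v j) := fun v => by
    conv_lhs => rw [← Finset.univ_sum_single v]
    rw [map_sum]
    rfl
  let x : L ⊗[R] CharacterModule K := ∑ j, s j ⊗ₜ χ j
  have hx : x = 0 := by
    apply hinj
    apply (TensorProduct.comm R _ _ ≪≫ₗ
      TensorProduct.piScalarRight R R (CharacterModule K) (Fin n)).injective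
    ext i k
    have := DFunLike.congr_fun hξ ((LinearMap.proj i).smulRight k)
    change η (ev ((LinearMap.proj i).smulRight k ∘ₗ L.subtype)) = 0 at this
    rw [hη] at this
    simp only [x, map_sum, map_zero, Finset.sum_apply, LinearEquiv.trans_apply,
      TensorProduct.piScalarRight_apply]
    refine (AddMonoidHom.finsetSum_apply (fun j => (s j : Fin n → R) i • χ j)
      Finset.univ k).trans ?_
    simp only [ev, LinearMap.pi_apply, LinearMap.applyₗ_apply_apply, LinearMap.comp_apply,
      LinearMap.smulRight_apply, LinearMap.proj_apply, Submodule.subtype_apply] at this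
    exact this
  ext φ
  change η (ev φ) = 0
  rw [hη]
  have h0 := congrArg (fun y => CharacterModule.uncurry (CharacterModule.dual φ)
    (TensorProduct.comm R L (CharacterModule K) y)) hx
  simp only [x, map_sum, map_zero, TensorProduct.comm_tmul] at h0
  exact h0

theorem exists_comp_eq_of_ker_le {A B C : Type u} [AddCommGroup A] [Module R A]
    [AddCommGroup B] [Module R B] [AddCommGroup C] [Module R C] (q : A →ₗ[R] B)
    (hq : Function.Surjective q) (f : A →ₗ[R] C) (hf : ∀ a, q a = 0 → f a = 0) :
    ∃ g : B →ₗ[R] C, g ∘ₗ q = f := by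
  let e := q.quotKerEquivOfSurjective hq
  refine ⟨(LinearMap.ker q).liftQ f hf ∘ₗ e.symm.toLinearMap, ?_⟩
  ext a
  have : e.symm (q a) = (LinearMap.ker q).mkQ a := by
    rw [LinearEquiv.symm_apply_eq]
    rfl
  rw [LinearMap.comp_apply, LinearMap.comp_apply, LinearEquiv.coe_coe, this]
  rfl

theorem exists_injective_embedding (K : Type u) [AddCommGroup K] [Module R K] :
    ∃ (E : Type u) (_ : AddCommGroup E) (_ : Module R E) (ι : K →ₗ[R] E),
      Module.Injective R E ∧ Function.Injective ι := by
  let E := CategoryTheory.Injective.under (ModuleCat.of R K)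
  refine ⟨E, inferInstance, inferInstance,
    (CategoryTheory.Injective.ι (ModuleCat.of R K)).hom, ?_, ?_⟩
  · exact (Module.injective_iff_injective_object R E).2
      (inferInstanceAs (CategoryTheory.Injective (CategoryTheory.Injective.under _)))
  · exact (ModuleCat.mono_iff_injective _).1 inferInstance

/-- Over a Noetherian ring whose ideals are strongly Gorenstein flat, flat modules have injective
dimension at most one. -/
theorem injective_quotient_of_flat [IsNoetherianRing R]
    (h : ∀ I : Ideal R, IsStronglyGorensteinFlat R I) {K E : Type u} [AddCommGroup K] [Module R K]
    [AddCommGroup E] [Module R E] [Module.Flat R K] (hE : Module.Injective R E) (ι : K →ₗ[R] E)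
    (hι : Function.Injective ι) : Module.Injective R (E ⧸ LinearMap.range ι) := by
  apply Module.Baer.injective
  intro I g
  obtain ⟨F, _, _, f, hF, hf, ⟨e⟩, htensor⟩ := h I
  obtain ⟨n, p, hp⟩ := Module.Finite.exists_fin' R I
  obtain ⟨β, hβ⟩ := Module.projective_lifting_property (LinearMap.range ι).mkQ (g ∘ₗ p)
    (Submodule.mkQ_surjective _)
  have hβ' : ∀ v, (LinearMap.range ι).mkQ (β v) = g (p v) := LinearMap.congr_fun hβ
  have hinj : Function.Injective
      ((LinearMap.ker p).subtype.rTensor (CharacterModule K)) := by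
    have := rTensor_ker_subtype_injective hf
      (htensor (CharacterModule K) _ _ (Module.Flat.iff_characterModule_injective.1 ‹_›))
      (e.toLinearMap ∘ₗ p) (e.surjective.comp hp)
    rwa [LinearEquiv.ker_comp] at this
  have hβK : ∀ v : LinearMap.ker p, β v ∈ LinearMap.range ι := fun v => by
    rw [← Submodule.Quotient.mk_eq_zero, ← Submodule.mkQ_apply, hβ', v.2, map_zero]
  let eK := LinearEquiv.ofInjective ι hι
  obtain ⟨γ, hγ⟩ := exists_extension_of_rTensor_characterModule_injective (LinearMap.ker p)
    (IsNoetherian.noetherian _) hinj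
    (eK.symm.toLinearMap ∘ₗ (β ∘ₗ (LinearMap.ker p).subtype).codRestrict _ hβK)
  have hγ' : ∀ v, p v = 0 → ι (γ v) = β v := fun v hv => by
    have := LinearMap.congr_fun hγ ⟨v, hv⟩
    have h2 := congrArg (fun z => (eK z : E)) this
    simp only [LinearMap.comp_apply, LinearEquiv.coe_coe, LinearEquiv.apply_symm_apply] at h2
    exact h2
  obtain ⟨δ, hδ⟩ := exists_comp_eq_of_ker_le p hp (β - ι ∘ₗ γ) fun v hv => by
    simp [hγ' v hv]
  obtain ⟨ε, hε⟩ := Module.Injective.extension_property R E I R I.subtype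
    I.injective_subtype δ
  refine ⟨(LinearMap.range ι).mkQ ∘ₗ ε, fun x hx => ?_⟩
  obtain ⟨v, hv⟩ := hp ⟨x, hx⟩
  have h1 : ε x = δ ⟨x, hx⟩ := LinearMap.congr_fun hε ⟨x, hx⟩
  have h2 : δ (p v) = β v - ι (γ v) := LinearMap.congr_fun hδ v
  have h3 : (LinearMap.range ι).mkQ (ι (γ v)) = 0 := by simp
  rw [LinearMap.comp_apply, h1, ← hv, h2, map_sub, hβ', h3, sub_zero]

/-- Vanishing of `Ext¹(N, K)` for `N` embedded in a projective module and `K` flat, phrased as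
an extension property. -/
theorem exists_extension_of_flat [IsNoetherianRing R]
    (h : ∀ I : Ideal R, IsStronglyGorensteinFlat R I) {A B N P K : Type u}
    [AddCommGroup A] [Module R A] [AddCommGroup B] [Module R B] [AddCommGroup N] [Module R N]
    [AddCommGroup P] [Module R P] [AddCommGroup K] [Module R K] [Module.Projective R P]
    [Module.Flat R K] {i : A →ₗ[R] B} {q : B →ₗ[R] N} {j : N →ₗ[R] P} (hi : Function.Injective i)
    (hq : Function.Surjective q) (hiq : Function.Exact i q) (hj : Function.Injective j)
    (φ : A →ₗ[R] K) : ∃ ψ : B →ₗ[R] K, ψ ∘ₗ i = φ := by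
  obtain ⟨E, _, _, ι, hE, hι⟩ := exists_injective_embedding (R := R) K
  have hEK := injective_quotient_of_flat h hE ι hι
  obtain ⟨θ, hθ⟩ := Module.Injective.extension_property R E A B i hi (ι ∘ₗ φ)
  have hθ' : ∀ a, θ (i a) = ι (φ a) := LinearMap.congr_fun hθ
  obtain ⟨g, hg⟩ := exists_comp_eq_of_ker_le q hq ((LinearMap.range ι).mkQ ∘ₗ θ) fun b hb => by
    obtain ⟨a, rfl⟩ := (hiq b).1 hb
    simp [hθ']
  obtain ⟨g', hg'⟩ := Module.Injective.extension_property R _ N P j hj g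
  obtain ⟨l, hl⟩ := Module.projective_lifting_property (LinearMap.range ι).mkQ g'
    (Submodule.mkQ_surjective _)
  have hmem : ∀ b, (θ - l ∘ₗ j ∘ₗ q) b ∈ LinearMap.range ι := fun b => by
    rw [← Submodule.Quotient.mk_eq_zero, ← Submodule.mkQ_apply, LinearMap.sub_apply, map_sub]
    have h1 : (LinearMap.range ι).mkQ (l (j (q b))) = g' (j (q b)) := LinearMap.congr_fun hl _
    have h2 : g' (j (q b)) = g (q b) := LinearMap.congr_fun hg' _
    have h3 : g (q b) = (LinearMap.range ι).mkQ (θ b) := LinearMap.congr_fun hg b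
    simp only [LinearMap.comp_apply]
    rw [h1, h2, h3, sub_self]
  let eK := LinearEquiv.ofInjective ι hι
  refine ⟨eK.symm.toLinearMap ∘ₗ (θ - l ∘ₗ j ∘ₗ q).codRestrict _ hmem, ?_⟩
  ext a
  apply eK.injective
  apply Subtype.ext
  simp [eK, hθ', hiq.apply_apply_eq_zero]

theorem flat_of_exact_of_flat {K P F : Type u} [AddCommGroup K] [Module R K] [AddCommGroup P]
    [Module R P] [AddCommGroup F] [Module R F] [Module.Flat R P] [Module.Flat R F]
    {i : K →ₗ[R] P} {q : P →ₗ[R] F} (hi : Function.Injective i) (hq : Function.Surjective q)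
    (hiq : Function.Exact i q) : Module.Flat R K := by
  rw [Module.Flat.iff_lTensor_preserves_injective_linearMap]
  intro M N _ _ _ _ f hf
  have h1 : Function.Injective (i.rTensor M) :=
    (i.lTensor_inj_iff_rTensor_inj M).1
      (LinearMap.lTensor_injective_of_exact_of_flat q hq i hi hiq M)
  have h2 : Function.Injective (f.lTensor P) :=
    Module.Flat.lTensor_preserves_injective_linearMap f hf
  have h3 : i.rTensor N ∘ₗ f.lTensor K = f.lTensor P ∘ₗ i.rTensor M := by
    rw [LinearMap.rTensor_comp_lTensor, LinearMap.lTensor_comp_rTensor]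
  refine Function.Injective.of_comp (f := i.rTensor N) ?_
  rw [← LinearMap.coe_comp, h3, LinearMap.coe_comp]
  exact h2.comp h1

/-- A flat module that embeds in a projective module is projective. -/
theorem projective_of_flat_of_injective [IsNoetherianRing R]
    (h : ∀ I : Ideal R, IsStronglyGorensteinFlat R I) {F P : Type u}
    [AddCommGroup F] [Module R F] [AddCommGroup P] [Module R P] [Module.Projective R P]
    [Module.Flat R F] {j : F →ₗ[R] P} (hj : Function.Injective j) : Module.Projective R F := by
  let q : (F →₀ R) →ₗ[R] F := Finsupp.linearCombination R id
  have hq : Function.Surjective q := Finsupp.linearCombination_id_surjective R F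
  have hexact := LinearMap.exact_subtype_ker_map q
  have hK : Module.Flat R (LinearMap.ker q) :=
    flat_of_exact_of_flat (K := LinearMap.ker q) (LinearMap.ker q).injective_subtype hq hexact
  obtain ⟨r, hr⟩ := exists_extension_of_flat (A := LinearMap.ker q) h (LinearMap.ker q).injective_subtype hq hexact hj
    LinearMap.id
  have hr' : ∀ v (hv : q v = 0), r v = ⟨v, hv⟩ := fun v hv => LinearMap.congr_fun hr ⟨v, hv⟩
  obtain ⟨s, hs⟩ := exists_comp_eq_of_ker_le q hq
    (LinearMap.id - (LinearMap.ker q).subtype ∘ₗ r) fun v hv => by simp [hr' v hv]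
  refine Module.Projective.of_split s q ?_
  ext x
  obtain ⟨v, rfl⟩ := hq x
  have : s (q v) = v - r v := LinearMap.congr_fun hs v
  have h0 : q (r v) = 0 := (r v).2
  simp [this, h0]

end

/-- Remark 3.2(iii), strong version: every Noetherian strongly Gorenstein semihereditary
ring is strongly Gorenstein hereditary. -/
theorem statement_12 (R : Type u) [CommRing R] (hN : IsNoetherianRing R)
    (h : IsSGSemihereditaryRing R) :
    IsSGHereditaryRing R := by
  intro P _ _ hP N
  have hI : ∀ I : Ideal R, IsStronglyGorensteinFlat R I := fun I =>
    h.2 R _ _ inferInstance I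
  obtain ⟨F, _, _, f, hF, hf, ⟨e⟩, -⟩ := h.2 P _ _ inferInstance N
  let j : LinearMap.range f →ₗ[R] P := N.subtype ∘ₗ e.symm.toLinearMap
  have hj : Function.Injective j := N.injective_subtype.comp e.symm.injective
  have hexact : Function.Exact (LinearMap.range f).subtype f.rangeRestrict := fun x => by
    rw [← LinearMap.mem_ker, LinearMap.ker_rangeRestrict, ← hf]
    simp
  obtain ⟨k, hk⟩ := exists_extension_of_flat hI (LinearMap.range f).injective_subtype
    f.surjective_rangeRestrict hexact hj j
  have hemb : Function.Injective (k.prod (j ∘ₗ f.rangeRestrict)) := by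
    rw [injective_iff_map_eq_zero]
    intro x hx
    have h1 : k x = 0 := congrArg Prod.fst hx
    have h2 : j (f.rangeRestrict x) = 0 := congrArg Prod.snd hx
    obtain ⟨y, rfl⟩ := (hexact x).1 ((map_eq_zero_iff j hj).1 h2)
    have h3 : j y = 0 := (LinearMap.congr_fun hk y).symm.trans h1
    rw [(map_eq_zero_iff j hj).1 h3, map_zero]
  refine ⟨F, _, _, f, projective_of_flat_of_injective hI hemb, hf, ⟨e⟩, ?_⟩
  intro Q _ _ hQ g hg
  obtain ⟨g', hg'⟩ := exists_comp_eq_of_ker_le f.rangeRestrict f.surjective_rangeRestrict g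
    fun x hx => by
      obtain ⟨⟨_, y, rfl⟩, rfl⟩ := (hexact x).1 hx
      exact LinearMap.congr_fun hg y
  obtain ⟨ψ, hψ⟩ := exists_extension_of_flat hI (LinearMap.range f).injective_subtype
    f.surjective_rangeRestrict hexact hj g'
  refine ⟨ψ, ?_⟩
  rw [← hg', ← hψ]
  rfl
end
end

section
/- A Gorenstein semihereditary commutative ring R is semihereditary if, and only if, the Gorenstein weak dimension G.wdim(R) is finite (in which case G.wdim(R) coincides with wdim(R)). Here it suffices to show: a G-semihereditary ring R is semihereditary if and only if wdim(R) is finite. -/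
noncomputable section

universe u

variable (R : Type u) [CommRing R]

/-- If `0 → A → B → C → 0` and `0 → L → P → N → 0` are exact with `P` flat and
`C ⊗ L → C ⊗ P` is injective, then so is `A ⊗ N → B ⊗ N`. -/
theorem rTensor_injective_of_lTensor_injective_s13 {R : Type*} [CommRing R]
    {A B C L P N : Type*} [AddCommGroup A] [Module R A] [AddCommGroup B] [Module R B]
    [AddCommGroup C] [Module R C] [AddCommGroup L] [Module R L] [AddCommGroup P] [Module R P]
    [AddCommGroup N] [Module R N] [Module.Flat R P]
    {f : A →ₗ[R] B} {g : B →ₗ[R] C} (hf : Function.Injective f) (hfg : Function.Exact f g)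
    (hg : Function.Surjective g) {i : L →ₗ[R] P} {p : P →ₗ[R] N} (hip : Function.Exact i p)
    (hp : Function.Surjective p) (h : Function.Injective (i.lTensor C)) :
    Function.Injective (f.rTensor N) := by
  rw [injective_iff_map_eq_zero]
  intro x hx
  obtain ⟨y, rfl⟩ := LinearMap.lTensor_surjective A hp x
  have hy : p.lTensor B (f.rTensor P y) = 0 := by
    rwa [← LinearMap.comp_apply, LinearMap.lTensor_comp_rTensor, ← LinearMap.rTensor_comp_lTensor]
  obtain ⟨z, hz⟩ := (lTensor_exact B hip hp _).1 hy
  have hz' : g.rTensor L z = 0 := by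
    apply h
    rw [map_zero, ← LinearMap.comp_apply, LinearMap.lTensor_comp_rTensor,
      ← LinearMap.rTensor_comp_lTensor, LinearMap.comp_apply, hz]
    exact (rTensor_exact P hfg hg).apply_apply_eq_zero y
  obtain ⟨w, rfl⟩ := (rTensor_exact L hfg hg _).1 hz'
  have hw : i.lTensor A w = y := by
    apply Module.Flat.rTensor_preserves_injective_linearMap (M := P) f hf
    rw [← hz, ← LinearMap.comp_apply, ← LinearMap.comp_apply, LinearMap.lTensor_comp_rTensor,
      LinearMap.rTensor_comp_lTensor]
  rw [← hw]
  exact (lTensor_exact A hip hp).apply_apply_eq_zero w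

/-- If `f : A → B` is injective with `A ⊗ L → B ⊗ L` injective and `B` flat, then tensoring with
`A` preserves the injectivity of `i : L → P`. -/
theorem lTensor_injective_of_rTensor_injective {R : Type*} [CommRing R]
    {A B L P : Type*} [AddCommGroup A] [Module R A] [AddCommGroup B] [Module R B]
    [AddCommGroup L] [Module R L] [AddCommGroup P] [Module R P] [Module.Flat R B]
    (f : A →ₗ[R] B) {i : L →ₗ[R] P} (hi : Function.Injective i)
    (h : Function.Injective (f.rTensor L)) : Function.Injective (i.lTensor A) := by
  refine Function.Injective.of_comp (f := f.rTensor P) ?_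
  rw [← LinearMap.coe_comp, LinearMap.rTensor_comp_lTensor, ← LinearMap.lTensor_comp_rTensor,
    LinearMap.coe_comp]
  exact (Module.Flat.lTensor_preserves_injective_linearMap i hi).comp h

/-- A short exact sequence `0 → L → P → M → 0` with `P` flat whose kernel has flat dimension at
most `n`, extracted from a flat resolution of `M` of length `n + 1`. -/
theorem FlatDimLE.exists_ker {R : Type u} [CommRing R] {M : Type u} [AddCommGroup M] [Module R M]
    {n : ℕ} (h : FlatDimLE R M (n + 1)) :
    ∃ (P : Type u) (_ : AddCommGroup P) (_ : Module R P) (ε : P →ₗ[R] M),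
      Module.Flat R P ∧ Function.Surjective ε ∧ FlatDimLE R (LinearMap.ker ε) n := by
  obtain ⟨F, _, _, d, ε, hF, hn, hε, h0, hd⟩ := h
  have hmem : ∀ x, d 0 x ∈ LinearMap.ker ε := fun x ↦ h0 ▸ LinearMap.mem_range_self _ x
  refine ⟨F 0, _, _, ε, hF 0, hε, fun i ↦ F (i + 1), inferInstance, inferInstance,
    fun i ↦ d (i + 1), (d 0).codRestrict _ hmem, fun i ↦ hF _, fun i hi ↦ hn _ (by omega), ?_, ?_,
    fun i ↦ hd _⟩
  · rintro ⟨x, hx⟩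
    rw [h0] at hx
    obtain ⟨y, rfl⟩ := hx
    exact ⟨y, rfl⟩
  · rw [LinearMap.ker_codRestrict, hd 0]

theorem FlatDimLE.flat_of_zero {R : Type u} [CommRing R] {M : Type u} [AddCommGroup M]
    [Module R M] (h : FlatDimLE R M 0) : Module.Flat R M := by
  obtain ⟨F, _, _, d, ε, hF, hn, hε, h0, -⟩ := h
  have := hF 0
  have := hn 1 one_pos
  have hinj : Function.Injective ε := by
    rw [← LinearMap.ker_eq_bot, h0, LinearMap.range_eq_bot]
    exact Subsingleton.elim _ _
  exact .of_linearEquiv (LinearEquiv.ofBijective ε ⟨hinj, hε⟩).symm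

/-- A Gorenstein flat module over a ring of finite weak global dimension is flat. -/
theorem IsGorensteinFlat.flat {R : Type u} [CommRing R] {n : ℕ}
    (hn : ∀ (M : Type u) (_ : AddCommGroup M) (_ : Module R M), FlatDimLE R M n)
    {M : Type u} [AddCommGroup M] [Module R M] (h : IsGorensteinFlat R M) : Module.Flat R M := by
  obtain ⟨F, _, _, d, hF, hd, ⟨e⟩, -⟩ := h
  have key : ∀ (n : ℕ) (i : ℤ) (N : Type u) (_ : AddCommGroup N) (_ : Module R N),
      FlatDimLE R N n → Function.Injective ((LinearMap.range (d i)).subtype.rTensor N) := by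
    intro n
    induction n with
    | zero =>
      intro i N _ _ hN
      have := hN.flat_of_zero
      exact Module.Flat.rTensor_preserves_injective_linearMap _ (Submodule.subtype_injective _)
    | succ n ih =>
      intro i N _ _ hN
      obtain ⟨P, _, _, ε, hP, hε, hL⟩ := hN.exists_ker
      refine rTensor_injective_of_lTensor_injective_s13 (g := (d (i + 1)).rangeRestrict)
        (Submodule.subtype_injective _) ?_ (LinearMap.surjective_rangeRestrict _)
        (LinearMap.exact_subtype_ker_map ε) hε ?_
      · rw [LinearMap.exact_iff, LinearMap.ker_rangeRestrict, Submodule.range_subtype, hd]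
      · exact lTensor_injective_of_rTensor_injective _ (Submodule.subtype_injective _)
          (ih (i + 1) _ _ _ hL)
  have : Module.Flat R (LinearMap.range (d 0)) :=
    Module.Flat.iff_lTensor_injective'.2 fun I ↦
      lTensor_injective_of_rTensor_injective _ (Submodule.subtype_injective _)
        (key n 0 _ _ _ (hn I _ _))
  exact .of_linearEquiv e

/-- Over a semihereditary ring, submodules of flat modules are flat. -/
theorem IsSemihereditaryRing.flat_submodule {R : Type u} [CommRing R]
    (h : IsSemihereditaryRing R) {P : Type*} [AddCommGroup P] [Module R P] [Module.Flat R P]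
    (K : Submodule R P) : Module.Flat R K :=
  Module.Flat.iff_lTensor_injective.2 fun I hI ↦
    have := h I hI
    lTensor_injective_of_rTensor_injective K.subtype (Submodule.subtype_injective _)
      (Module.Flat.rTensor_preserves_injective_linearMap _ (Submodule.subtype_injective _))

/-- A flat module with a flat submodule gives a flat resolution of length one of the quotient. -/
theorem flatDimLE_one {R : Type u} [CommRing R] {P M : Type u} [AddCommGroup P] [Module R P]
    [AddCommGroup M] [Module R M] [Module.Flat R P] (ε : P →ₗ[R] M) (hε : Function.Surjective ε)
    [Module.Flat R (LinearMap.ker ε)] : FlatDimLE R M 1 := by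
  let F : ℕ → ModuleCat.{u} R
    | 0 => .of R P
    | 1 => .of R (LinearMap.ker ε)
    | _ + 2 => .of R PUnit.{u + 1}
  let d : ∀ i, F (i + 1) →ₗ[R] F i
    | 0 => (LinearMap.ker ε).subtype
    | _ + 1 => 0
  refine ⟨fun i ↦ F i, inferInstance, inferInstance, d, ε, ?_, ?_, hε, ?_, ?_⟩
  · rintro (_ | _ | i)
    · exact ‹Module.Flat R P›
    · exact ‹Module.Flat R (LinearMap.ker ε)›
    · exact (inferInstance : Module.Flat R PUnit.{u + 1})
  · rintro (_ | _ | i) hi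
    · omega
    · omega
    · exact (inferInstance : Subsingleton PUnit.{u + 1})
  · exact (Submodule.range_subtype _).symm
  · rintro (_ | i)
    · exact (Submodule.ker_subtype _).trans LinearMap.range_zero.symm
    · have : Subsingleton (F (i + 1 + 1)) := (inferInstance : Subsingleton PUnit.{u + 1})
      exact Subsingleton.elim _ _

theorem IsFinitelyPresented.finitePresentation {R : Type u} [CommRing R] {M : Type u}
    [AddCommGroup M] [Module R M] (h : IsFinitelyPresented R M) :
    Module.FinitePresentation R M :=
  have ⟨_, f, hf, hker⟩ := h
  Module.finitePresentation_of_free_of_surjective f hf hker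

/-- Remark 3.2(i): a Gorenstein semihereditary ring is semihereditary if and only if its
weak global dimension is finite. -/
theorem statement_13 (R : Type u) [CommRing R] (h : IsGSemihereditaryRing R) :
    IsSemihereditaryRing R ↔
      ∃ n : ℕ, ∀ (M : Type u) (_ : AddCommGroup M) (_ : Module R M), FlatDimLE R M n := by
  constructor
  · intro hs
    refine ⟨1, fun M _ _ ↦ ?_⟩
    have := hs.flat_submodule (LinearMap.ker (Finsupp.linearCombination R (id : M → M)))
    exact flatDimLE_one _ (Finsupp.linearCombination_id_surjective R M)
  · rintro ⟨n, hn⟩ I hI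
    have := (h.1 I hI).finitePresentation
    have := (h.2 R _ _ inferInstance I).flat hn
    exact Module.Flat.projective_of_finitePresentation
end
end
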